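/- For every s ≥ 1/2 there is C > 0 such that for all integers n ≥ 2, all t ∈ ℝ, and all v, w : ℤ → ℂ with ‖v‖_{H^s}, ‖w‖_{H^s} < ∞: ‖N^{(n)}(v)(t)‖_{H^s} ≤ C n (log n) ‖v‖³_{H^s}, and ‖N^{(n)}(v)(t) − N^{(n)}(w)(t)‖_{H^s} ≤ C n (log n) (‖v‖_{H^s} + ‖w‖_{H^s})² ‖v − w‖_{H^s}. -/

import Mathlib

open scoped ENNReal

/-- Japanese bracket `⟨k⟩ = 1 + |k|`. -/
noncomputable def jb (k : ℤ) : ℝ := 1 + |(k : ℝ)|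

/-- `‖f‖_{H^s} = (∑_k ⟨k⟩^{2s} |f k|²)^{1/2}`, valued in `[0,∞]`. -/
noncomputable def hnorm (s : ℝ) (f : ℤ → ℂ) : ℝ≥0∞ :=
  (∑' k : ℤ, ENNReal.ofReal (jb k ^ (2 * s) * ‖f k‖ ^ 2)) ^ (1 / 2 : ℝ)

/-- `Φ(k̄) = k³ − k₁³ − k₂³ − k₃³` with `k = k₁ + k₂ + k₃`. -/
def Phi (k₁ k₂ k₃ : ℤ) : ℤ := (k₁ + k₂ + k₃) ^ 3 - k₁ ^ 3 - k₂ ^ 3 - k₃ ^ 3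

/-- Summand of the non-resonant part, parametrized by `(k₁, k₂)` with `k₃ = k - k₁ - k₂`. -/
noncomputable def ntermF (v : ℤ → ℂ) (t : ℝ) (k : ℤ) (p : ℤ × ℤ) : ℂ :=
  if Phi p.1 p.2 (k - p.1 - p.2) ≠ 0 then
    (k : ℂ) * Complex.exp (Complex.I * (t : ℂ) * ((Phi p.1 p.2 (k - p.1 - p.2) : ℤ) : ℂ)) *
      v p.1 * v p.2 * v (k - p.1 - p.2)
  else 0

/-- Non-resonant part `N(v)(t)_k`. -/
noncomputable def Nonres (v : ℤ → ℂ) (t : ℝ) (k : ℤ) : ℂ :=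
  Complex.I / 3 * ∑' p : ℤ × ℤ, ntermF v t k p

/-- Dirichlet projection onto frequencies `{|k| ≤ n}`. -/
noncomputable def trunc (n : ℕ) (v : ℤ → ℂ) : ℤ → ℂ :=
  fun k => if |k| ≤ (n : ℤ) then v k else 0

/-- The low-frequency non-resonant part `N^{(n)}(v)(t)_k`. -/
noncomputable def Nlow (n : ℕ) (v : ℤ → ℂ) (t : ℝ) (k : ℤ) : ℂ :=
  Nonres (trunc n v) t k

theorem tsum_mul_sq_le {ι : Type*} (a b : ι → ℝ≥0∞) :
    (∑' i, a i * b i) ^ 2 ≤ (∑' i, a i ^ 2) * ∑' i, b i ^ 2 := by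
  let _ : MeasurableSpace ι := ⊤
  have h := ENNReal.lintegral_mul_le_Lp_mul_Lq (MeasureTheory.Measure.count (α := ι))
    Real.HolderConjugate.two_two (f := a) (g := b)
    measurable_from_top.aemeasurable measurable_from_top.aemeasurable
  simp only [MeasureTheory.lintegral_count, Pi.mul_apply, ENNReal.rpow_two] at h
  rw [← ENNReal.mul_rpow_of_nonneg _ _ (by norm_num)] at h
  calc _ ≤ _ := pow_le_pow_left' h 2
    _ = _ := by rw [← ENNReal.rpow_natCast, ← ENNReal.rpow_mul]; norm_num

theorem tsum_weight_mul_sq_le {ι : Type*} (g u : ι → ℝ≥0∞) :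
    (∑' i, g i * u i) ^ 2 ≤ (∑' i, g i) * ∑' i, g i * u i ^ 2 := by
  have hsq (x : ℝ≥0∞) : (x ^ (1 / 2 : ℝ)) ^ 2 = x := by
    rw [← ENNReal.rpow_natCast, ← ENNReal.rpow_mul]; norm_num
  have h := tsum_mul_sq_le (fun i ↦ g i ^ (1 / 2 : ℝ)) (fun i ↦ g i ^ (1 / 2 : ℝ) * u i)
  simp only [mul_pow, hsq, ← mul_assoc, ← sq] at h
  exact h

/-- Young's inequality `ℓ¹ * ℓ² ⊆ ℓ²` for a superposition of translates. -/
theorem tsum_translates_sq_le {ι : Type*} (g : ι → ℝ≥0∞) (σ : ι → ℤ) (f : ℤ → ℝ≥0∞) :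
    ∑' k, (∑' i, g i * f (k - σ i)) ^ 2 ≤ (∑' i, g i) ^ 2 * ∑' k, f k ^ 2 := by
  calc _ ≤ ∑' k, (∑' i, g i) * ∑' i, g i * f (k - σ i) ^ 2 :=
        ENNReal.tsum_le_tsum fun k ↦ tsum_weight_mul_sq_le _ _
    _ = (∑' i, g i) * ∑' i, g i * ∑' k, f (k - σ i) ^ 2 := by
        rw [ENNReal.tsum_mul_left, ENNReal.tsum_comm]; simp only [ENNReal.tsum_mul_left]
    _ = _ := by
        have h (i : ι) : ∑' k, f (k - σ i) ^ 2 = ∑' k, f k ^ 2 :=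
          (Equiv.subRight (σ i)).tsum_eq fun k ↦ f k ^ 2
        simp only [h, ENNReal.tsum_mul_right]; ring

/-- The triple convolution on `ℤ`. -/
noncomputable def conv₃ (a b c : ℤ → ℝ≥0∞) (k : ℤ) : ℝ≥0∞ :=
  ∑' p : ℤ × ℤ, a p.1 * b p.2 * c (k - p.1 - p.2)

theorem conv₃_swap_left (a b c : ℤ → ℝ≥0∞) : conv₃ a b c = conv₃ b a c := by
  ext k
  unfold conv₃
  rw [← (Equiv.prodComm ℤ ℤ).tsum_eq]
  refine tsum_congr fun p ↦ ?_
  simp only [Equiv.prodComm_apply, Prod.fst_swap, Prod.snd_swap, sub_right_comm k p.2]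
  ring

theorem conv₃_swap_right (a b c : ℤ → ℝ≥0∞) : conv₃ a b c = conv₃ a c b := by
  ext k
  unfold conv₃
  rw [← (Equiv.prodShear (Equiv.refl ℤ) fun x ↦ Equiv.subLeft (k - x)).tsum_eq]
  refine tsum_congr fun p ↦ ?_
  simp [Equiv.prodShear]
  ring

theorem tsum_conv₃_sq_le (a b c : ℤ → ℝ≥0∞) :
    ∑' k, conv₃ a b c k ^ 2 ≤ (∑' k, a k) ^ 2 * (∑' k, b k) ^ 2 * ∑' k, c k ^ 2 := by
  have h := tsum_translates_sq_le (fun p : ℤ × ℤ ↦ a p.1 * b p.2) (fun p ↦ p.1 + p.2) c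
  rw [ENNReal.tsum_prod (f := fun x y ↦ a x * b y)] at h
  simpa only [conv₃, ENNReal.tsum_mul_left, ENNReal.tsum_mul_right, mul_pow, sub_sub] using h

theorem one_le_jb (k : ℤ) : 1 ≤ jb k := by simp [jb]

theorem jb_pos (k : ℤ) : 0 < jb k := zero_lt_one.trans_le (one_le_jb k)

theorem sum_inv_jb_le (n : ℕ) :
    ∑ k ∈ Finset.Icc (-n : ℤ) n, (jb k)⁻¹ ≤ 2 * (harmonic (n + 1) : ℝ) := by
  induction n with
  | zero => simp [jb]
  | succ n ih =>
    have h : Finset.Icc (-(n + 1 : ℕ) : ℤ) (n + 1 : ℕ) =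
        insert (n + 1 : ℤ) (insert (-(n + 1) : ℤ) (Finset.Icc (-n : ℤ) n)) := by
      ext k; simp only [Finset.mem_Icc, Finset.mem_insert]; omega
    rw [h, Finset.sum_insert (by simp; omega), Finset.sum_insert (by simp), harmonic_succ]
    have h1 : jb (n + 1 : ℤ) = n + 1 + 1 := by
      rw [jb]; push_cast; rw [abs_of_nonneg (by positivity)]; ring
    have h2 : jb (-(n + 1) : ℤ) = n + 1 + 1 := by
      rw [jb]; push_cast; rw [abs_neg, abs_of_nonneg (by positivity)]; ring
    rw [h1, h2]
    push_cast
    linarith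

theorem sum_inv_jb_le_log {n : ℕ} (hn : 2 ≤ n) :
    ∑ k ∈ Finset.Icc (-n : ℤ) n, (jb k)⁻¹ ≤ 8 * Real.log n := by
  have hn' : (2 : ℝ) ≤ n := by exact_mod_cast hn
  have h1 := sum_inv_jb_le n
  have h2 := harmonic_le_one_add_log (n + 1)
  have h3 : Real.log 2 ≤ Real.log n := Real.log_le_log (by norm_num) hn'
  have h4 : Real.log (n + 1 : ℕ) ≤ 2 * Real.log n := by
    rw [show 2 * Real.log n = Real.log ((n : ℝ) ^ 2) by simp]
    exact Real.log_le_log (by positivity) (by push_cast; nlinarith)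
  linarith [Real.log_two_gt_d9]

/-- The Sobolev weight `⟨k⟩ˢ`. -/
noncomputable def sobolevWeight (s : ℝ) (k : ℤ) : ℝ≥0∞ := ENNReal.ofReal (jb k ^ s)

/-- The squared weighted norm `∑ₖ (⟨k⟩ˢ f k)²`. -/
noncomputable def sobolevEnergy (s : ℝ) (f : ℤ → ℝ≥0∞) : ℝ≥0∞ :=
  ∑' k, (sobolevWeight s k * f k) ^ 2

theorem hnorm_eq (s : ℝ) (f : ℤ → ℂ) :
    hnorm s f = sobolevEnergy s (fun k ↦ ‖f k‖ₑ) ^ (1 / 2 : ℝ) := by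
  unfold hnorm sobolevEnergy sobolevWeight
  congr 2 with k
  have hk := (jb_pos k).le
  beta_reduce
  rw [← ofReal_norm, ← ENNReal.ofReal_mul (by positivity), ← ENNReal.ofReal_pow (by positivity),
    mul_pow, ← Real.rpow_natCast (jb k ^ s), ← Real.rpow_mul hk, mul_comm s]
  norm_num

theorem hnorm_sq (s : ℝ) (f : ℤ → ℂ) :
    hnorm s f ^ 2 = sobolevEnergy s (fun k ↦ ‖f k‖ₑ) := by
  rw [hnorm_eq, ← ENNReal.rpow_natCast, ← ENNReal.rpow_mul]; norm_num

theorem sobolevEnergy_mono (s : ℝ) {f g : ℤ → ℝ≥0∞} (h : ∀ k, f k ≤ g k) :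
    sobolevEnergy s f ≤ sobolevEnergy s g :=
  ENNReal.tsum_le_tsum fun k ↦ by gcongr; exact h k

theorem sobolevWeight_ne_zero (s : ℝ) (k : ℤ) : sobolevWeight s k ≠ 0 := by
  have := Real.rpow_pos_of_pos (jb_pos k) s
  simpa [sobolevWeight] using this

theorem sq_tsum_le_log_mul_sobolevEnergy {s : ℝ} (hs : 1 / 2 ≤ s) {n : ℕ} (hn : 2 ≤ n)
    {b : ℤ → ℝ≥0∞} (hb : ∀ k : ℤ, ¬|k| ≤ (n : ℤ) → b k = 0) :
    (∑' k, b k) ^ 2 ≤ ENNReal.ofReal (8 * Real.log n) * sobolevEnergy s b := by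
  let I := Finset.Icc (-n : ℤ) n
  have hI (k : ℤ) : k ∈ I ↔ |k| ≤ (n : ℤ) := by simp [I, abs_le]
  let g : ℤ → ℝ≥0∞ := fun k ↦ if k ∈ I then (sobolevWeight s k)⁻¹ else 0
  have hg : ∑' k, b k = ∑' k, g k * (sobolevWeight s k * b k) := by
    refine tsum_congr fun k ↦ ?_
    by_cases hk : k ∈ I
    · simp only [g, if_pos hk, ← mul_assoc]
      rw [ENNReal.inv_mul_cancel (sobolevWeight_ne_zero s k) ENNReal.ofReal_ne_top, one_mul]
    · simp [hb k (mt (hI k).2 hk)]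
  rw [hg]
  refine (tsum_mul_sq_le _ _).trans (mul_le_mul_left ?_ _)
  rw [tsum_eq_sum (s := I) fun k hk ↦ by simp [g, hk]]
  calc ∑ k ∈ I, g k ^ 2 ≤ ∑ k ∈ I, ENNReal.ofReal (jb k)⁻¹ := by
        refine Finset.sum_le_sum fun k hk ↦ ?_
        have hk1 := one_le_jb k
        have hk0 := jb_pos k
        simp only [g, if_pos hk, sobolevWeight]
        rw [← ENNReal.ofReal_inv_of_pos (by positivity), ← ENNReal.ofReal_pow (by positivity),
          inv_pow]
        refine ENNReal.ofReal_le_ofReal (inv_anti₀ hk0 ?_)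
        rw [← Real.rpow_natCast, ← Real.rpow_mul hk0.le]
        exact Real.self_le_rpow_of_one_le hk1 (by push_cast; linarith)
    _ = ENNReal.ofReal (∑ k ∈ I, (jb k)⁻¹) :=
        (ENNReal.ofReal_sum_of_nonneg fun k _ ↦ inv_nonneg.2 (jb_pos k).le).symm
    _ ≤ _ := ENNReal.ofReal_le_ofReal (sum_inv_jb_le_log hn)

theorem sobolevWeight_le {s : ℝ} (hs : 0 ≤ s) (k k₁ k₂ : ℤ) :
    sobolevWeight s k ≤ ENNReal.ofReal (3 ^ s) *
      (sobolevWeight s k₁ + sobolevWeight s k₂ + sobolevWeight s (k - k₁ - k₂)) := by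
  have h1 := jb_pos k₁
  have h2 := jb_pos k₂
  have h3 := jb_pos (k - k₁ - k₂)
  have h0 : jb k ≤ jb k₁ + jb k₂ + jb (k - k₁ - k₂) := by
    have h := abs_add_three (k₁ : ℝ) k₂ (k - k₁ - k₂)
    simp only [jb]
    push_cast
    rw [show (k₁ : ℝ) + k₂ + (k - k₁ - k₂) = k by ring] at h
    linarith
  unfold sobolevWeight
  rw [← ENNReal.ofReal_add (by positivity) (by positivity),
    ← ENNReal.ofReal_add (by positivity) (by positivity), ← ENNReal.ofReal_mul (by positivity)]
  refine ENNReal.ofReal_le_ofReal ?_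
  have key {m : ℝ} (hm : 0 < m) (h : jb k ≤ 3 * m) : jb k ^ s ≤ 3 ^ s * m ^ s := by
    rw [← Real.mul_rpow (by norm_num) hm.le]
    exact Real.rpow_le_rpow (jb_pos k).le h hs
  have p1 := Real.rpow_pos_of_pos h1 s
  have p2 := Real.rpow_pos_of_pos h2 s
  have p3 := Real.rpow_pos_of_pos h3 s
  obtain h | h | h : jb k ≤ 3 * jb k₁ ∨ jb k ≤ 3 * jb k₂ ∨ jb k ≤ 3 * jb (k - k₁ - k₂) := by
    by_contra! h
    linarith [h.1, h.2.1, h.2.2]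
  · exact (key h1 h).trans (by gcongr; linarith)
  · exact (key h2 h).trans (by gcongr; linarith)
  · exact (key h3 h).trans (by gcongr; linarith)

theorem add_three_sq_le (x y z : ℝ≥0∞) :
    (x + y + z) ^ 2 ≤ 3 * (x ^ 2 + y ^ 2 + z ^ 2) := by
  by_cases h : x = ⊤ ∨ y = ⊤ ∨ z = ⊤
  · obtain rfl | rfl | rfl := h <;> simp
  · push Not at h
    lift x to NNReal using h.1
    lift y to NNReal using h.2.1
    lift z to NNReal using h.2.2
    norm_cast
    rw [← NNReal.coe_le_coe]
    push_cast
    nlinarith [sq_nonneg ((x : ℝ) - y), sq_nonneg ((y : ℝ) - z), sq_nonneg ((x : ℝ) - z)]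

theorem tsum_add_three_sq_le (f g h : ℤ → ℝ≥0∞) :
    ∑' k, (f k + g k + h k) ^ 2 ≤ 3 * (∑' k, f k ^ 2 + ∑' k, g k ^ 2 + ∑' k, h k ^ 2) := by
  rw [← ENNReal.tsum_add, ← ENNReal.tsum_add, ← ENNReal.tsum_mul_left]
  exact ENNReal.tsum_le_tsum fun k ↦ add_three_sq_le _ _ _

theorem sobolevEnergy_add_three_le (s : ℝ) (f g h : ℤ → ℝ≥0∞) :
    sobolevEnergy s (fun k ↦ f k + g k + h k) ≤
      3 * (sobolevEnergy s f + sobolevEnergy s g + sobolevEnergy s h) := by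
  simp only [sobolevEnergy, mul_add (sobolevWeight s _)]
  exact tsum_add_three_sq_le _ _ _

theorem sobolevWeight_mul_conv₃_le {s : ℝ} (hs : 0 ≤ s) (a b c : ℤ → ℝ≥0∞) (k : ℤ) :
    sobolevWeight s k * conv₃ a b c k ≤ ENNReal.ofReal (3 ^ s) *
      (conv₃ (fun k ↦ sobolevWeight s k * a k) b c k +
        conv₃ a (fun k ↦ sobolevWeight s k * b k) c k +
        conv₃ a b (fun k ↦ sobolevWeight s k * c k) k) := by
  unfold conv₃
  rw [← ENNReal.tsum_add, ← ENNReal.tsum_add, ← ENNReal.tsum_mul_left, ← ENNReal.tsum_mul_left]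
  refine ENNReal.tsum_le_tsum fun p ↦ ?_
  refine (mul_le_mul_left (sobolevWeight_le hs k p.1 p.2) _).trans_eq ?_
  ring

/-- The trilinear estimate: each factor in `ℓ¹` costs `(log n)^{1/2}`. -/
theorem sobolevEnergy_conv₃_le {s : ℝ} (hs : 1 / 2 ≤ s) {n : ℕ} (hn : 2 ≤ n)
    {a b c : ℤ → ℝ≥0∞} (ha : ∀ k : ℤ, ¬|k| ≤ (n : ℤ) → a k = 0)
    (hb : ∀ k : ℤ, ¬|k| ≤ (n : ℤ) → b k = 0) (hc : ∀ k : ℤ, ¬|k| ≤ (n : ℤ) → c k = 0) :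
    sobolevEnergy s (conv₃ a b c) ≤ 9 * ENNReal.ofReal (3 ^ s * (8 * Real.log n)) ^ 2 *
      (sobolevEnergy s a * sobolevEnergy s b * sobolevEnergy s c) := by
  have hA := sq_tsum_le_log_mul_sobolevEnergy hs hn ha
  have hB := sq_tsum_le_log_mul_sobolevEnergy hs hn hb
  have hC := sq_tsum_le_log_mul_sobolevEnergy hs hn hc
  set L := ENNReal.ofReal (8 * Real.log n)
  set E := sobolevEnergy s
  set J := sobolevWeight s
  have h1 : ∑' k, conv₃ (fun k ↦ J k * a k) b c k ^ 2 ≤ L ^ 2 * (E a * E b * E c) := by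
    rw [conv₃_swap_left, conv₃_swap_right]
    calc _ ≤ (L * E b) * (L * E c) * E a := (tsum_conv₃_sq_le _ _ _).trans (by gcongr; rfl)
      _ = _ := by ring
  have h2 : ∑' k, conv₃ a (fun k ↦ J k * b k) c k ^ 2 ≤ L ^ 2 * (E a * E b * E c) := by
    rw [conv₃_swap_right]
    calc _ ≤ (L * E a) * (L * E c) * E b := (tsum_conv₃_sq_le _ _ _).trans (by gcongr; rfl)
      _ = _ := by ring
  have h3 : ∑' k, conv₃ a b (fun k ↦ J k * c k) k ^ 2 ≤ L ^ 2 * (E a * E b * E c) := by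
    calc _ ≤ (L * E a) * (L * E b) * E c := (tsum_conv₃_sq_le _ _ _).trans (by gcongr; rfl)
      _ = _ := by ring
  rw [ENNReal.ofReal_mul (by positivity)]
  calc E (conv₃ a b c)
      ≤ ∑' k, (ENNReal.ofReal (3 ^ s) * (conv₃ (fun k ↦ J k * a k) b c k +
        conv₃ a (fun k ↦ J k * b k) c k + conv₃ a b (fun k ↦ J k * c k) k)) ^ 2 :=
        ENNReal.tsum_le_tsum fun k ↦
          pow_le_pow_left' (sobolevWeight_mul_conv₃_le (by linarith) a b c k) 2
    _ ≤ ENNReal.ofReal (3 ^ s) ^ 2 * (3 * (L ^ 2 * (E a * E b * E c) +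
          L ^ 2 * (E a * E b * E c) + L ^ 2 * (E a * E b * E c))) := by
        simp only [mul_pow, ENNReal.tsum_mul_left]
        gcongr
        exact (tsum_add_three_sq_le _ _ _).trans (by gcongr)
    _ = _ := by ring

theorem trunc_eq_zero {n : ℕ} (v : ℤ → ℂ) {k : ℤ} (hk : ¬|k| ≤ (n : ℤ)) : trunc n v k = 0 :=
  if_neg hk

theorem enorm_trunc_le (n : ℕ) (v : ℤ → ℂ) (k : ℤ) : ‖trunc n v k‖ₑ ≤ ‖v k‖ₑ := by
  unfold trunc
  split_ifs <;> simp

theorem trunc_sub (n : ℕ) (v w : ℤ → ℂ) (k : ℤ) :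
    trunc n (fun k ↦ v k - w k) k = trunc n v k - trunc n w k := by
  unfold trunc
  split_ifs <;> simp

theorem summable_ntermF_trunc (n : ℕ) (v : ℤ → ℂ) (t : ℝ) (k : ℤ) :
    Summable (ntermF (trunc n v) t k) := by
  refine summable_of_ne_finset_zero (s := Finset.Icc (-n : ℤ) n ×ˢ Finset.Icc (-n : ℤ) n)
    fun p hp ↦ ?_
  have h : ¬(|p.1| ≤ (n : ℤ) ∧ |p.2| ≤ (n : ℤ)) := by
    simpa only [Finset.mem_product, Finset.mem_Icc, abs_le] using hp
  obtain h | h := not_and_or.1 h <;> simp [ntermF, trunc_eq_zero v h]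

theorem enorm_mul_three_le {n : ℕ} {a b c : ℤ → ℂ}
    (ha : ∀ k : ℤ, ¬|k| ≤ (n : ℤ) → a k = 0) (hb : ∀ k : ℤ, ¬|k| ≤ (n : ℤ) → b k = 0)
    (hc : ∀ k : ℤ, ¬|k| ≤ (n : ℤ) → c k = 0) (k : ℤ) (p : ℤ × ℤ) :
    ‖(k : ℂ) * (a p.1 * b p.2 * c (k - p.1 - p.2))‖ₑ ≤
      3 * n * (‖a p.1‖ₑ * ‖b p.2‖ₑ * ‖c (k - p.1 - p.2)‖ₑ) := by
  by_cases h1 : |p.1| ≤ (n : ℤ)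
  swap; · simp [ha _ h1]
  by_cases h2 : |p.2| ≤ (n : ℤ)
  swap; · simp [hb _ h2]
  by_cases h3 : |k - p.1 - p.2| ≤ (n : ℤ)
  swap; · simp [hc _ h3]
  have hk : k.natAbs ≤ 3 * n := by rw [abs_le] at h1 h2 h3; omega
  have hk' : ‖(k : ℂ)‖ₑ ≤ 3 * n := by
    rw [← ofReal_norm, Complex.norm_intCast, ← Int.cast_abs, ← Nat.cast_natAbs,
      ENNReal.ofReal_natCast]
    exact_mod_cast hk
  simp only [enorm_mul]
  gcongr

theorem enorm_ntermF_trunc_sub_le (n : ℕ) (v w : ℤ → ℂ) (t : ℝ) (k : ℤ) (p : ℤ × ℤ) :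
    ‖ntermF (trunc n v) t k p - ntermF (trunc n w) t k p‖ₑ ≤ 3 * n *
      (‖trunc n (fun k ↦ v k - w k) p.1‖ₑ * ‖trunc n v p.2‖ₑ * ‖trunc n v (k - p.1 - p.2)‖ₑ +
        ‖trunc n w p.1‖ₑ * ‖trunc n (fun k ↦ v k - w k) p.2‖ₑ * ‖trunc n v (k - p.1 - p.2)‖ₑ +
        ‖trunc n w p.1‖ₑ * ‖trunc n w p.2‖ₑ * ‖trunc n (fun k ↦ v k - w k) (k - p.1 - p.2)‖ₑ) := by
  unfold ntermF
  split_ifs with h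
  swap; · simp
  set m := Phi p.1 p.2 (k - p.1 - p.2)
  have he : ‖Complex.exp (Complex.I * (t : ℂ) * (m : ℂ))‖ₑ = 1 := by
    rw [← ofReal_norm, show Complex.I * (t : ℂ) * (m : ℂ) = ((t * m : ℝ) : ℂ) * Complex.I by
      push_cast; ring, Complex.norm_exp_ofReal_mul_I, ENNReal.ofReal_one]
  set d := trunc n (fun k ↦ v k - w k)
  set a := trunc n v
  set b := trunc n w
  set q := k - p.1 - p.2
  have hsub (j : ℤ) : d j = a j - b j := trunc_sub n v w j
  have heq : (k : ℂ) * Complex.exp (Complex.I * (t : ℂ) * (m : ℂ)) * a p.1 * a p.2 * a q -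
      (k : ℂ) * Complex.exp (Complex.I * (t : ℂ) * (m : ℂ)) * b p.1 * b p.2 * b q =
      Complex.exp (Complex.I * (t : ℂ) * (m : ℂ)) * ((k : ℂ) * (d p.1 * a p.2 * a q) +
        (k : ℂ) * (b p.1 * d p.2 * a q) + (k : ℂ) * (b p.1 * b p.2 * d q)) := by
    simp only [hsub]; ring
  have z (u : ℤ → ℂ) : ∀ j : ℤ, ¬|j| ≤ (n : ℤ) → trunc n u j = 0 := fun _ ↦ trunc_eq_zero u
  rw [heq, enorm_mul, he, one_mul, mul_add, mul_add]
  refine (enorm_add_le _ _).trans <| add_le_add ?_ ?_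
  · refine (enorm_add_le _ _).trans <| add_le_add ?_ ?_
    · exact enorm_mul_three_le (z _) (z _) (z _) k p
    · exact enorm_mul_three_le (z _) (z _) (z _) k p
  · exact enorm_mul_three_le (z _) (z _) (z _) k p

theorem enorm_Nlow_sub_le (n : ℕ) (v w : ℤ → ℂ) (t : ℝ) (k : ℤ) :
    ‖Nlow n v t k - Nlow n w t k‖ₑ ≤ n *
      (conv₃ (‖trunc n (fun k ↦ v k - w k) ·‖ₑ) (‖trunc n v ·‖ₑ) (‖trunc n v ·‖ₑ) k +
        conv₃ (‖trunc n w ·‖ₑ) (‖trunc n (fun k ↦ v k - w k) ·‖ₑ) (‖trunc n v ·‖ₑ) k +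
        conv₃ (‖trunc n w ·‖ₑ) (‖trunc n w ·‖ₑ) (‖trunc n (fun k ↦ v k - w k) ·‖ₑ) k) := by
  have h3 : ‖Complex.I / 3‖ₑ * 3 = 1 := by
    rw [show (3 : ℝ≥0∞) = ‖(3 : ℂ)‖ₑ by rw [← ofReal_norm]; simp, ← enorm_mul,
      div_mul_cancel₀ _ (by norm_num), ← ofReal_norm]
    simp
  unfold Nlow Nonres
  rw [← mul_sub, ← (summable_ntermF_trunc n v t k).tsum_sub (summable_ntermF_trunc n w t k),
    enorm_mul]
  refine (mul_le_mul_right (enorm_tsum_le_tsum_enorm.trans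
    (ENNReal.tsum_le_tsum (enorm_ntermF_trunc_sub_le n v w t k))) _).trans_eq ?_
  rw [ENNReal.tsum_mul_left, ← mul_assoc, ← mul_assoc, h3, one_mul, ENNReal.tsum_add,
    ENNReal.tsum_add]
  rfl

theorem hnorm_Nlow_sub_le {s : ℝ} (hs : 1 / 2 ≤ s) {n : ℕ} (hn : 2 ≤ n) (t : ℝ) (v w : ℤ → ℂ) :
    hnorm s (fun k ↦ Nlow n v t k - Nlow n w t k) ≤
      ENNReal.ofReal (48 * 3 ^ s * n * Real.log n) * (hnorm s v + hnorm s w) ^ 2 *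
        hnorm s (fun k ↦ v k - w k) := by
  have z (u : ℤ → ℂ) : ∀ j : ℤ, ¬|j| ≤ (n : ℤ) → ‖trunc n u j‖ₑ = 0 := fun j hj ↦ by
    rw [trunc_eq_zero u hj, enorm_zero]
  have htri (a b c : ℤ → ℂ) : sobolevEnergy s
      (conv₃ (‖trunc n a ·‖ₑ) (‖trunc n b ·‖ₑ) (‖trunc n c ·‖ₑ)) ≤
      9 * ENNReal.ofReal (3 ^ s * (8 * Real.log n)) ^ 2 *
        (hnorm s a ^ 2 * hnorm s b ^ 2 * hnorm s c ^ 2) := by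
    simp only [hnorm_sq]
    refine (sobolevEnergy_conv₃_le hs hn (z a) (z b) (z c)).trans ?_
    gcongr <;> exact sobolevEnergy_mono s (enorm_trunc_le n _)
  rw [← ENNReal.pow_le_pow_left_iff two_ne_zero, hnorm_sq]
  set D := hnorm s (fun k ↦ v k - w k)
  set V := hnorm s v
  set W := hnorm s w
  set L := ENNReal.ofReal (3 ^ s * (8 * Real.log n)) with hL
  have hconst : ENNReal.ofReal (48 * 3 ^ s * n * Real.log n) = 6 * n * L := by
    rw [hL, show 48 * 3 ^ s * n * Real.log n = 6 * n * (3 ^ s * (8 * Real.log n)) by ring,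
      ENNReal.ofReal_mul (by positivity), ENNReal.ofReal_mul (by norm_num)]
    simp
  calc sobolevEnergy s (fun k ↦ ‖Nlow n v t k - Nlow n w t k‖ₑ)
      ≤ _ := sobolevEnergy_mono s (enorm_Nlow_sub_le n v w t)
    _ ≤ (n : ℝ≥0∞) ^ 2 * (3 * (9 * L ^ 2 * (D ^ 2 * V ^ 2 * V ^ 2) +
          9 * L ^ 2 * (W ^ 2 * D ^ 2 * V ^ 2) + 9 * L ^ 2 * (W ^ 2 * W ^ 2 * D ^ 2))) := by
        unfold sobolevEnergy
        simp only [mul_left_comm _ (n : ℝ≥0∞), mul_pow (n : ℝ≥0∞), ENNReal.tsum_mul_left]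
        gcongr
        exact (sobolevEnergy_add_three_le s _ _ _).trans
          (by gcongr <;> exact htri _ _ _)
    _ = 27 * ((n : ℝ≥0∞) ^ 2 * L ^ 2 * D ^ 2) * (V ^ 4 + W ^ 2 * V ^ 2 + W ^ 4) := by ring
    _ ≤ 36 * ((n : ℝ≥0∞) ^ 2 * L ^ 2 * D ^ 2) * (V + W) ^ 4 := by
        gcongr
        · norm_num
        · calc _ ≤ (V ^ 4 + W ^ 2 * V ^ 2 + W ^ 4) +
                (4 * V ^ 3 * W + 5 * V ^ 2 * W ^ 2 + 4 * V * W ^ 3) := le_self_add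
            _ = _ := by ring
    _ = _ := by rw [hconst]; ring

theorem hnorm_zero (s : ℝ) : hnorm s (fun _ ↦ 0) = 0 := by
  simp [hnorm]

theorem Nlow_zero (n : ℕ) (t : ℝ) (k : ℤ) : Nlow n (fun _ ↦ 0) t k = 0 := by
  simp [Nlow, Nonres, ntermF, trunc]

/-- Estimates for `N^{(n)}`: `‖N^{(n)}(v)(t)‖_{H^s} ≲ n log n ‖v‖³_{H^s}` and the
corresponding difference estimate, for `s ≥ 1/2`. -/
theorem low_frequency_estimates (s : ℝ) (hs : 1 / 2 ≤ s) :
    ∃ C > (0 : ℝ), ∀ n : ℕ, 2 ≤ n → ∀ t : ℝ,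
      (∀ v : ℤ → ℂ, hnorm s v < ⊤ →
        hnorm s (fun k => Nlow n v t k) ≤
          ENNReal.ofReal (C * n * Real.log n) * hnorm s v ^ 3) ∧
      (∀ v w : ℤ → ℂ, hnorm s v < ⊤ → hnorm s w < ⊤ →
        hnorm s (fun k => Nlow n v t k - Nlow n w t k) ≤
          ENNReal.ofReal (C * n * Real.log n) * (hnorm s v + hnorm s w) ^ 2 *
            hnorm s (fun k => v k - w k)) := by
  refine ⟨48 * 3 ^ s, by positivity, fun n hn t ↦
    ⟨fun v _ ↦ ?_, fun v w _ _ ↦ hnorm_Nlow_sub_le hs hn t v w⟩⟩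
  have h := hnorm_Nlow_sub_le hs hn t v fun _ ↦ 0
  simpa only [Nlow_zero, sub_zero, hnorm_zero, add_zero, mul_assoc, ← pow_succ] using h
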